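/- arXiv:1204.4355 — 2 statements merged into one kernel-verified Lean document; each statement's English description precedes it below -/
import Mathlib

section
/- Let K = F_3(x)[y]/(y^2 + x^5+x^4+x^2+2x) be the quadratic function field over F_3(x) obtained by adjoining a root y of the irreducible polynomial Y^2 + (x^5+x^4+x^2+2x). Then the polynomial T^4 + (x^3+x)T^2 + 2x^6+2x^5+x^4+2x^3+2x^2, in the variable T with coefficients in K, is irreducible over K. -/
open Polynomial

/-- `x` denotes the generator `X` of the rational function field `F₃(x)`. -/
noncomputable def x : RatFunc (ZMod 3) := RatFunc.X

/-- The defining polynomial `Y² + (x⁵+x⁴+x²+2x)` of the genus-2 base field over `F₃`. -/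
noncomputable def p : Polynomial (RatFunc (ZMod 3)) :=
  X ^ 2 + C (x ^ 5 + x ^ 4 + x ^ 2 + 2 * x)

/-- The image of `x` in `K = F₃(x)[y]/(p)`. -/
noncomputable def xK : AdjoinRoot p := AdjoinRoot.of p x

/-- A monic quadratic polynomial in terms of its coefficients. -/
theorem Polynomial.Monic.eq_quadratic {R : Type*} [CommRing R] {f : R[X]} (hf : f.Monic)
    (hd : f.natDegree = 2) : f = X ^ 2 + C (f.coeff 1) * X + C (f.coeff 0) := by
  have h := hf.as_sum
  rw [hd] at h
  simp only [Finset.sum_range_succ, Finset.sum_range_zero, zero_add, pow_zero, pow_one,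
    mul_one] at h
  calc f = _ := h
    _ = _ := by ring

/-- A biquadratic polynomial over a field is irreducible as soon as neither its constant
coefficient nor its discriminant as a polynomial in `T ^ 2` is a square. -/
theorem irreducible_biquadratic {F : Type*} [Field F] {a b : F} (hb : ∀ z, z ^ 2 ≠ b)
    (hD : ∀ z, z ^ 2 ≠ a ^ 2 - 4 * b) : Irreducible (X ^ 4 + C a * X ^ 2 + C b : F[X]) := by
  have hdeg : (X ^ 4 + C a * X ^ 2 + C b : F[X]).natDegree = 4 := by compute_degree!
  have hm : (X ^ 4 + C a * X ^ 2 + C b : F[X]).Monic := by monicity!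
  rw [hm.irreducible_iff_natDegree']
  refine ⟨fun h => by simp [h] at hdeg, fun f g hf hg hfg hmem => ?_⟩
  have hsum : f.natDegree + g.natDegree = 4 := by rw [← hf.natDegree_mul hg, hfg, hdeg]
  rw [hdeg, Finset.mem_Ioc] at hmem
  obtain h1 | h2 : g.natDegree = 1 ∨ g.natDegree = 2 := by omega
  · have hg1 := hg.eq_X_add_C h1
    have hev := congrArg (eval (-g.coeff 0)) hfg
    rw [eval_mul, hg1] at hev
    simp at hev
    exact hD (2 * g.coeff 0 ^ 2 + a) (by linear_combination -4 * hev)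
  · have hf2 := hf.eq_quadratic (by omega)
    have hg2 := hg.eq_quadratic h2
    generalize f.coeff 1 = u at hf2
    generalize f.coeff 0 = v at hf2
    generalize g.coeff 1 = s at hg2
    generalize g.coeff 0 = w at hg2
    have hz : (C (u + s) * X ^ 3 + C (v + w + u * s - a) * X ^ 2 + C (u * w + v * s) * X
        + C (v * w - b) : F[X]) = 0 := by
      rw [hf2, hg2] at hfg
      simp only [C_add, C_sub, C_mul]
      linear_combination hfg
    have c0 := congrArg (coeff · 0) hz
    have c1 := congrArg (coeff · 1) hz
    have c2 := congrArg (coeff · 2) hz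
    have c3 := congrArg (coeff · 3) hz
    simp [coeff_X, coeff_C, -map_add, -map_sub, -map_mul] at c0 c1 c2 c3
    obtain rfl : s = -u := by linear_combination c3
    obtain h | h : u = 0 ∨ w - v = 0 := mul_eq_zero.mp (by linear_combination c1)
    · subst h
      exact hD (v - w) (by linear_combination (v + w + a) * c2 - 4 * c0)
    · exact hb v (by linear_combination c0 - v * h)

/-- If the square of an element of a quadratic extension `F(√(-d))` lies in `F`, then it is either
a square in `F` or `-d` times a square. -/
theorem AdjoinRoot.eq_sq_or_of_sq_eq_of {F : Type*} [Field F] (h2 : (2 : F) ≠ 0) {d c : F}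
    {z : AdjoinRoot (X ^ 2 + C d)} (hz : z ^ 2 = AdjoinRoot.of _ c) :
    ∃ r : F, c = r ^ 2 ∨ c = -d * r ^ 2 := by
  have hm : (X ^ 2 + C d : F[X]).Monic := by monicity!
  have hd : (X ^ 2 + C d : F[X]).natDegree = 2 := by compute_degree!
  obtain ⟨g, rfl⟩ := AdjoinRoot.mk_surjective z
  have hg : AdjoinRoot.mk (X ^ 2 + C d) g = AdjoinRoot.mk _ (g %ₘ (X ^ 2 + C d)) :=
    AdjoinRoot.mk_eq_mk.mpr ⟨g /ₘ (X ^ 2 + C d), by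
      linear_combination -(modByMonic_add_div g (X ^ 2 + C d))⟩
  have hlt := natDegree_modByMonic_lt g hm (fun h => by simp [h] at hd)
  obtain ⟨s, r, hsr⟩ := exists_eq_X_add_C_of_natDegree_le_one
    (show (g %ₘ (X ^ 2 + C d)).natDegree ≤ 1 by omega)
  rw [hg, hsr, ← map_pow, ← AdjoinRoot.mk_C, AdjoinRoot.mk_eq_mk] at hz
  have hdvd : (X ^ 2 + C d) ∣ C (2 * r * s) * X + C (r ^ 2 - s ^ 2 * d - c) := by
    convert dvd_sub hz (dvd_mul_right (X ^ 2 + C d) (C (s ^ 2))) using 1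
    simp only [C_sub, C_mul, C_pow, C_ofNat]
    ring
  have hzero := eq_zero_of_dvd_of_natDegree_lt hdvd (by
    rw [hd]; exact lt_of_le_of_lt natDegree_linear_le one_lt_two)
  have c0 := congrArg (coeff · 0) hzero
  have c1 := congrArg (coeff · 1) hzero
  simp [coeff_X, coeff_C, h2, -map_add, -map_sub, -map_mul, -map_pow] at c0 c1
  obtain rfl | rfl := c1
  · exact ⟨s, .inr (by linear_combination -c0)⟩
  · exact ⟨r, .inl (by linear_combination -c0)⟩

/-- A rational function whose square times a polynomial is a polynomial gives a polynomial
identity after clearing denominators. -/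
theorem RatFunc.exists_mul_sq_eq {F : Type*} [Field F] {P Q : F[X]} {r : RatFunc F}
    (h : algebraMap F[X] (RatFunc F) P = algebraMap F[X] (RatFunc F) Q * r ^ 2) :
    ∃ m n : F[X], n ≠ 0 ∧ P * n ^ 2 = Q * m ^ 2 := by
  refine ⟨r.num, r.denom, r.denom_ne_zero, RatFunc.algebraMap_injective F ?_⟩
  have hn : algebraMap F[X] (RatFunc F) r.denom ≠ 0 :=
    RatFunc.algebraMap_ne_zero r.denom_ne_zero
  have hr : algebraMap F[X] (RatFunc F) r.num = r * algebraMap F[X] (RatFunc F) r.denom := by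
    rw [← div_eq_iff hn, RatFunc.num_div_denom]
  simp only [map_mul, map_pow, hr, h]
  ring

/-- A polynomial over `F₃` of even degree with leading coefficient `2` does not become a square
in `K`. -/
theorem sq_ne_of_algebraMap {P : (ZMod 3)[X]} (hl : P.leadingCoeff = 2) (he : Even P.natDegree)
    (z : AdjoinRoot p) : z ^ 2 ≠ AdjoinRoot.of p (algebraMap (ZMod 3)[X] (RatFunc (ZMod 3)) P) := by
  intro hz
  have hP : P ≠ 0 := by rintro rfl; simp at hl; revert hl; decide
  have h2 : (2 : RatFunc (ZMod 3)) ≠ 0 := by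
    have : (2 : RatFunc (ZMod 3)) = algebraMap (ZMod 3) _ 2 := (map_ofNat _ 2).symm
    rw [this]
    exact (_root_.map_ne_zero _).mpr (by decide)
  obtain ⟨r, hr | hr⟩ := AdjoinRoot.eq_sq_or_of_sq_eq_of h2 hz
  · obtain ⟨m, n, hn0, hmn⟩ := RatFunc.exists_mul_sq_eq (P := P) (Q := 1) (r := r) (by simpa using hr)
    have hlc := congrArg leadingCoeff hmn
    simp only [leadingCoeff_mul, leadingCoeff_pow, one_mul, hl] at hlc
    have hn : n.leadingCoeff ≠ 0 := leadingCoeff_ne_zero.mpr hn0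
    revert hn hlc
    generalize n.leadingCoeff = u
    generalize m.leadingCoeff = v
    revert u v
    decide
  · have hf : (-(X ^ 5 + X ^ 4 + X ^ 2 + 2 * X) : (ZMod 3)[X]).natDegree = 5 := by
      rw [natDegree_neg]; compute_degree!
    obtain ⟨m, n, hn, hmn⟩ := RatFunc.exists_mul_sq_eq (P := P)
      (Q := -(X ^ 5 + X ^ 4 + X ^ 2 + 2 * X)) (r := r) (by simpa [x, map_ofNat (algebraMap (ZMod 3)[X] (RatFunc (ZMod 3))) 2] using hr)
    have hm : m ≠ 0 := by rintro rfl; simp [hP, hn] at hmn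
    have hd := congrArg natDegree hmn
    rw [natDegree_mul hP (pow_ne_zero 2 hn), natDegree_mul (fun h => by simp [h] at hf)
      (pow_ne_zero 2 hm), natDegree_pow, natDegree_pow, hf] at hd
    obtain ⟨k, hk⟩ := he
    omega

/-- Assuming `p` is irreducible (so that `K = AdjoinRoot p` is the quadratic function field
`F₃(x)(y)`), the polynomial `T⁴ + (x³+x)T² + 2x⁶+2x⁵+x⁴+2x³+2x²` is irreducible over `K`. -/
theorem stmt_7 [Fact (Irreducible p)] :
    Irreducible (X ^ 4 + C (xK ^ 3 + xK) * X ^ 2 +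
      C (2 * xK ^ 6 + 2 * xK ^ 5 + xK ^ 4 + 2 * xK ^ 3 + 2 * xK ^ 2)) := by
  have h3 : (3 : AdjoinRoot p) = 0 := by
    have h : (algebraMap (ZMod 3) (AdjoinRoot p)) 3 = 0 := by
      rw [show (3 : ZMod 3) = 0 by decide, map_zero]
    rwa [map_ofNat] at h
  have hx : AdjoinRoot.of p RatFunc.X = xK := rfl
  refine irreducible_biquadratic (fun z hz => ?_) (fun z hz => ?_)
  · have hd : (2 * X ^ 6 + 2 * X ^ 5 + X ^ 4 + 2 * X ^ 3 + 2 * X ^ 2 : (ZMod 3)[X]).natDegree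
        = 6 := by
      compute_degree!
    refine sq_ne_of_algebraMap (P := 2 * X ^ 6 + 2 * X ^ 5 + X ^ 4 + 2 * X ^ 3 + 2 * X ^ 2)
      ?_ (by rw [hd]; decide) z (hz.trans ?_)
    · rw [leadingCoeff, hd]
      compute_degree!
    · simp only [map_add, map_mul, map_pow, map_ofNat, RatFunc.algebraMap_X, hx]
  · have hd : (2 * X ^ 6 + X ^ 5 + X ^ 4 + X ^ 3 + 2 * X ^ 2 : (ZMod 3)[X]).natDegree = 6 := by
      compute_degree!
    refine sq_ne_of_algebraMap (P := 2 * X ^ 6 + X ^ 5 + X ^ 4 + X ^ 3 + 2 * X ^ 2)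
      ?_ (by rw [hd]; decide) z (hz.trans ?_)
    · rw [leadingCoeff, hd]
      compute_degree!
    · simp only [map_add, map_mul, map_pow, map_ofNat, RatFunc.algebraMap_X, hx]
      linear_combination (-3 * xK ^ 6 - 3 * xK ^ 5 - xK ^ 4 - 3 * xK ^ 3 - 3 * xK ^ 2) * h3
end

section
/- Let K = F_3(x)[y]/(y^2 + x^5+x^4+x^2+2x) be the quadratic function field over F_3(x) obtained by adjoining a root y of the irreducible polynomial Y^2 + (x^5+x^4+x^2+2x), and let L = K[T_1]/(T_1^4 + (x^3+x)T_1^2 + 2x^6+2x^5+x^4+2x^3+2x^2) be the field obtained from K by adjoining a root T_1 of that irreducible quartic. Then the polynomial T_2^2 + (x+1)y + x^3+x^2+x+1, in the variable T_2 with coefficients in L, is irreducible over L. (Consequently the compositum L(T_2) has degree 8 over K; it is the record curve of genus 17 with 28 rational points over F_3.) -/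
open Polynomial

/-- The adjoined root `y` in `K = F₃(x)[y]/(p)`. -/
noncomputable def y : AdjoinRoot p := AdjoinRoot.root p

/-- The quartic `T₁⁴ + (x³+x)T₁² + 2x⁶+2x⁵+x⁴+2x³+2x²` over `K`, defining
`L = K[T₁]/(q)`. -/
noncomputable def q : Polynomial (AdjoinRoot p) :=
  X ^ 4 + C (xK ^ 3 + xK) * X ^ 2 +
    C (2 * xK ^ 6 + 2 * xK ^ 5 + xK ^ 4 + 2 * xK ^ 3 + 2 * xK ^ 2)

lemma exists_natDegree_and_leadingCoeff_of_sq_eq {r : RatFunc (ZMod 3)} {P : (ZMod 3)[X]}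
    (hP : P ≠ 0) (h : r ^ 2 = algebraMap _ _ P) :
    Even P.natDegree ∧ P.leadingCoeff = 1 := by
  have hd : r.denom ≠ 0 := r.denom_ne_zero
  have hd' : algebraMap (ZMod 3)[X] (RatFunc (ZMod 3)) r.denom ≠ 0 :=
    RatFunc.algebraMap_ne_zero hd
  have key : r.num ^ 2 = P * r.denom ^ 2 := by
    apply RatFunc.algebraMap_injective (ZMod 3)
    rw [← RatFunc.num_div_denom r, div_pow, div_eq_iff (pow_ne_zero 2 hd')] at h
    simpa using h
  constructor
  · have := congrArg natDegree key
    rw [natDegree_mul hP (pow_ne_zero 2 hd), natDegree_pow, natDegree_pow] at this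
    exact ⟨r.num.natDegree - r.denom.natDegree, by omega⟩
  · have hl := congrArg leadingCoeff key
    rw [leadingCoeff_mul, leadingCoeff_pow, leadingCoeff_pow] at hl
    have h0 : r.denom.leadingCoeff ≠ 0 := leadingCoeff_ne_zero.mpr hd
    have h1 : P.leadingCoeff ≠ 0 := leadingCoeff_ne_zero.mpr hP
    revert hl h0 h1
    generalize P.leadingCoeff = a
    generalize r.denom.leadingCoeff = b
    generalize r.num.leadingCoeff = c
    revert a b c
    decide

lemma three_eq_zero_ratFunc : (3 : RatFunc (ZMod 3)) = 0 := by
  have := congrArg (algebraMap (ZMod 3) (RatFunc (ZMod 3))) (show (3 : ZMod 3) = 0 from rfl)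
  simpa only [map_ofNat, map_zero] using this

lemma three_eq_zero_adjoinRoot_p : (3 : AdjoinRoot p) = 0 := by
  have := congrArg (AdjoinRoot.of p) three_eq_zero_ratFunc
  simpa only [map_ofNat, map_zero] using this

lemma monic_p : p.Monic := by
  unfold p; monicity!

lemma natDegree_p : p.natDegree = 2 := by
  unfold p; compute_degree!

lemma monic_q [Fact (Irreducible p)] : q.Monic := by
  unfold q; monicity!

lemma natDegree_q [Fact (Irreducible p)] : q.natDegree = 4 := by
  unfold q; compute_degree!

lemma y_sq : y ^ 2 = -(xK ^ 5 + xK ^ 4 + xK ^ 2 + 2 * xK) := by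
  have h : AdjoinRoot.mk p p = 0 := AdjoinRoot.mk_self
  conv at h => lhs; arg 2; unfold p
  simp only [map_add, map_pow, AdjoinRoot.mk_X, AdjoinRoot.mk_C, map_mul, map_ofNat] at h
  exact eq_neg_of_add_eq_zero_left h

lemma exists_eq_add_mul_y (z : AdjoinRoot p) :
    ∃ a b, z = AdjoinRoot.of p a + AdjoinRoot.of p b * y := by
  obtain ⟨g, rfl⟩ := AdjoinRoot.mk_surjective z
  have hdeg : (g %ₘ p).natDegree < 2 := by
    rw [← natDegree_p]
    exact natDegree_modByMonic_lt g monic_p fun h => by simpa [h] using natDegree_p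
  refine ⟨(g %ₘ p).coeff 0, (g %ₘ p).coeff 1, ?_⟩
  have h : AdjoinRoot.mk p (g %ₘ p) = AdjoinRoot.mk p g := by
    conv_rhs => rw [← modByMonic_add_div g p]
    simp
  rw [← h, (g %ₘ p).as_sum_range_C_mul_X_pow' hdeg]
  simp [Finset.sum_range_succ, y]

lemma eq_zero_of_add_mul_y_eq_zero {a b : RatFunc (ZMod 3)}
    (h : AdjoinRoot.of p a + AdjoinRoot.of p b * y = 0) : a = 0 ∧ b = 0 := by
  have hm : AdjoinRoot.mk p (C a + C b * X) = 0 := by simpa [y] using h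
  have h0 : C a + C b * X = 0 := by
    refine eq_zero_of_dvd_of_natDegree_lt (AdjoinRoot.mk_eq_zero.mp hm) ?_
    rw [natDegree_p]
    have : (C a + C b * X).natDegree ≤ 1 := by compute_degree
    omega
  exact ⟨by simpa using congrArg (coeff · 0) h0, by simpa using congrArg (coeff · 1) h0⟩

lemma root_q_pow_four [Fact (Irreducible p)] :
    AdjoinRoot.root q ^ 4 = -(AdjoinRoot.of q (xK ^ 3 + xK) * AdjoinRoot.root q ^ 2 +
      AdjoinRoot.of q (2 * xK ^ 6 + 2 * xK ^ 5 + xK ^ 4 + 2 * xK ^ 3 + 2 * xK ^ 2)) := by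
  have h : AdjoinRoot.mk q q = 0 := AdjoinRoot.mk_self
  conv at h => lhs; arg 2; unfold q
  rw [map_add, map_add, map_mul, map_pow, map_pow, AdjoinRoot.mk_X, AdjoinRoot.mk_C,
    AdjoinRoot.mk_C] at h
  rw [add_assoc] at h
  exact eq_neg_of_add_eq_zero_left h

lemma exists_eq_cubic_root_q [Fact (Irreducible p)] (z : AdjoinRoot q) :
    ∃ a b c d, z = AdjoinRoot.of q a + AdjoinRoot.of q b * AdjoinRoot.root q +
      AdjoinRoot.of q c * AdjoinRoot.root q ^ 2 + AdjoinRoot.of q d * AdjoinRoot.root q ^ 3 := by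
  obtain ⟨g, rfl⟩ := AdjoinRoot.mk_surjective z
  have hdeg : (g %ₘ q).natDegree < 4 := by
    rw [← natDegree_q]
    exact natDegree_modByMonic_lt g monic_q fun h => by simpa [h] using natDegree_q
  refine ⟨(g %ₘ q).coeff 0, (g %ₘ q).coeff 1, (g %ₘ q).coeff 2, (g %ₘ q).coeff 3, ?_⟩
  have h : AdjoinRoot.mk q (g %ₘ q) = AdjoinRoot.mk q g := by
    conv_rhs => rw [← modByMonic_add_div g q]
    simp
  rw [← h, (g %ₘ q).as_sum_range_C_mul_X_pow' hdeg]
  simp [Finset.sum_range_succ]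

lemma eq_zero_of_cubic_root_q_eq_zero [Fact (Irreducible p)] {a b c d : AdjoinRoot p}
    (h : AdjoinRoot.of q a + AdjoinRoot.of q b * AdjoinRoot.root q +
      AdjoinRoot.of q c * AdjoinRoot.root q ^ 2 +
      AdjoinRoot.of q d * AdjoinRoot.root q ^ 3 = 0) :
    a = 0 ∧ b = 0 ∧ c = 0 ∧ d = 0 := by
  have hm : AdjoinRoot.mk q (C a + C b * X + C c * X ^ 2 + C d * X ^ 3) = 0 := by simpa using h
  have h0 : C a + C b * X + C c * X ^ 2 + C d * X ^ 3 = 0 := by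
    refine eq_zero_of_dvd_of_natDegree_lt (AdjoinRoot.mk_eq_zero.mp hm) ?_
    rw [natDegree_q]
    have : (C a + C b * X + C c * X ^ 2 + C d * X ^ 3).natDegree ≤ 3 := by compute_degree
    omega
  refine ⟨by simpa [coeff_X, coeff_C] using congrArg (coeff · 0) h0,
    by simpa [coeff_X, coeff_C, coeff_X_pow] using congrArg (coeff · 1) h0,
    by simpa [coeff_X, coeff_C, coeff_X_pow] using congrArg (coeff · 2) h0,
    by simpa [coeff_X, coeff_C, coeff_X_pow] using congrArg (coeff · 3) h0⟩

lemma x_add_one_ne_zero : x + 1 ≠ 0 := by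
  have h : x + 1 = algebraMap (ZMod 3)[X] _ (X + C 1) := by simp [x]
  rw [h]
  exact RatFunc.algebraMap_ne_zero (X_add_C_ne_zero 1)

lemma constCoeff_q_not_sq [Fact (Irreducible p)] (z : AdjoinRoot p) :
    z ^ 2 ≠ 2 * xK ^ 6 + 2 * xK ^ 5 + xK ^ 4 + 2 * xK ^ 3 + 2 * xK ^ 2 := by
  intro h
  obtain ⟨a, b, rfl⟩ := exists_eq_add_mul_y z
  obtain ⟨h1, h2⟩ := eq_zero_of_add_mul_y_eq_zero
    (a := a ^ 2 - b ^ 2 * (x ^ 5 + x ^ 4 + x ^ 2 + 2 * x) -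
      (2 * x ^ 6 + 2 * x ^ 5 + x ^ 4 + 2 * x ^ 3 + 2 * x ^ 2)) (b := 2 * a * b) (by
      simp only [map_add, map_sub, map_mul, map_pow, map_ofNat]
      change _ ^ 2 - _ * (xK ^ 5 + xK ^ 4 + xK ^ 2 + 2 * xK) -
        (2 * xK ^ 6 + 2 * xK ^ 5 + xK ^ 4 + 2 * xK ^ 3 + 2 * xK ^ 2) + _ = 0
      linear_combination h - (AdjoinRoot.of p b) ^ 2 * y_sq)
  have hab : a * b = 0 := by linear_combination -h2 + a * b * three_eq_zero_ratFunc
  rcases mul_eq_zero.mp hab with rfl | rfl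
  · have hdeg : ((2 * X ^ 6 + 2 * X ^ 5 + X ^ 4 + 2 * X ^ 3 + 2 * X ^ 2) *
        (2 * (X ^ 5 + X ^ 4 + X ^ 2 + 2 * X)) : (ZMod 3)[X]).natDegree = 11 := by
      have e1 : (2 * X ^ 6 + 2 * X ^ 5 + X ^ 4 + 2 * X ^ 3 + 2 * X ^ 2 : (ZMod 3)[X]).natDegree
        = 6 := by
        compute_degree!
      have e2 : (2 * (X ^ 5 + X ^ 4 + X ^ 2 + 2 * X) : (ZMod 3)[X]).natDegree = 5 := by
        compute_degree!
      rw [natDegree_mul (fun h => by simp [h] at e1) (fun h => by simp [h] at e2), e1, e2]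
    have := (exists_natDegree_and_leadingCoeff_of_sq_eq
      (r := b * (x ^ 5 + x ^ 4 + x ^ 2 + 2 * x)) (P := (2 * X ^ 6 + 2 * X ^ 5 + X ^ 4 + 2 * X ^ 3 + 2 * X ^ 2) *
        (2 * (X ^ 5 + X ^ 4 + X ^ 2 + 2 * X))) (fun h => by simp [h] at hdeg) (by
        simp only [map_add, map_mul, map_pow, map_ofNat, RatFunc.algebraMap_X]
        change _ = (2 * x ^ 6 + 2 * x ^ 5 + x ^ 4 + 2 * x ^ 3 + 2 * x ^ 2) *
          (2 * (x ^ 5 + x ^ 4 + x ^ 2 + 2 * x))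
        linear_combination (-(x ^ 5 + x ^ 4 + x ^ 2 + 2 * x)) * h1 -
          (2 * x ^ 6 + 2 * x ^ 5 + x ^ 4 + 2 * x ^ 3 + 2 * x ^ 2) *
          (x ^ 5 + x ^ 4 + x ^ 2 + 2 * x) * three_eq_zero_ratFunc)).1
    rw [hdeg] at this
    revert this
    decide
  · have hdeg : (2 * X ^ 6 + 2 * X ^ 5 + X ^ 4 + 2 * X ^ 3 + 2 * X ^ 2 : (ZMod 3)[X]).natDegree
        = 6 := by
      compute_degree!
    have := (exists_natDegree_and_leadingCoeff_of_sq_eq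
      (r := a) (P := 2 * X ^ 6 + 2 * X ^ 5 + X ^ 4 + 2 * X ^ 3 + 2 * X ^ 2) (fun h => by simp [h] at hdeg) (by
        simp only [map_add, map_mul, map_pow, map_ofNat, RatFunc.algebraMap_X]
        change _ = (2 * x ^ 6 + 2 * x ^ 5 + x ^ 4 + 2 * x ^ 3 + 2 * x ^ 2)
        linear_combination h1)).2
    rw [leadingCoeff, hdeg] at this
    have hc : (2 * X ^ 6 + 2 * X ^ 5 + X ^ 4 + 2 * X ^ 3 + 2 * X ^ 2 : (ZMod 3)[X]).coeff 6
        = 2 := by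
      compute_degree!
    rw [hc] at this
    revert this
    decide

/-- The radicand has a norm of odd degree, so it is not a square in `K` up to a factor
from `F₃(x)`. -/
lemma of_mul_sq_ne_neg_radicand [Fact (Irreducible p)] (D : RatFunc (ZMod 3))
    (z : AdjoinRoot p) :
    AdjoinRoot.of p D * z ^ 2 ≠ -((xK + 1) * y + xK ^ 3 + xK ^ 2 + xK + 1) := by
  intro h
  obtain ⟨a, b, rfl⟩ := exists_eq_add_mul_y z
  obtain ⟨h1, h2⟩ := eq_zero_of_add_mul_y_eq_zero
    (a := D * (a ^ 2 - b ^ 2 * (x ^ 5 + x ^ 4 + x ^ 2 + 2 * x)) + (x ^ 3 + x ^ 2 + x + 1))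
    (b := D * (2 * a * b) + (x + 1)) (by
      simp only [map_add, map_sub, map_mul, map_pow, map_ofNat, map_one]
      change _ * (_ ^ 2 - _ * (xK ^ 5 + xK ^ 4 + xK ^ 2 + 2 * xK)) +
        (xK ^ 3 + xK ^ 2 + xK + 1) + (_ + (xK + 1)) * _ = 0
      linear_combination h - AdjoinRoot.of p D * (AdjoinRoot.of p b) ^ 2 * y_sq)
  have hdeg : (X ^ 5 + 2 * X ^ 4 + 2 * X + 1 : (ZMod 3)[X]).natDegree = 5 := by
    compute_degree!
  have := (exists_natDegree_and_leadingCoeff_of_sq_eq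
    (r := D * (a ^ 2 + b ^ 2 * (x ^ 5 + x ^ 4 + x ^ 2 + 2 * x)) / (x + 1))
    (P := X ^ 5 + 2 * X ^ 4 + 2 * X + 1)
    (fun h => by simp [h] at hdeg) (by
      simp only [map_add, map_mul, map_pow, map_ofNat, map_one, RatFunc.algebraMap_X]
      change _ = x ^ 5 + 2 * x ^ 4 + 2 * x + 1
      rw [div_pow, div_eq_iff (pow_ne_zero 2 x_add_one_ne_zero)]
      linear_combination
        (D * (a ^ 2 - b ^ 2 * (x ^ 5 + x ^ 4 + x ^ 2 + 2 * x)) - (x ^ 3 + x ^ 2 + x + 1)) * h1 +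
        (x ^ 5 + x ^ 4 + x ^ 2 + 2 * x) * (D * (2 * a * b) - (x + 1)) * h2 +
        (x + 1) ^ 2 * x ^ 2 * three_eq_zero_ratFunc)).1
  rw [hdeg] at this
  revert this
  decide

lemma radicand_ne_zero [Fact (Irreducible p)] :
    (xK + 1) * y + xK ^ 3 + xK ^ 2 + xK + 1 ≠ 0 := fun h =>
  of_mul_sq_ne_neg_radicand 0 0 (by simp [h])

lemma sq_ne_neg_radicand [Fact (Irreducible p)] [Fact (Irreducible q)] (z : AdjoinRoot q) :
    z ^ 2 ≠ -AdjoinRoot.of q ((xK + 1) * y + xK ^ 3 + xK ^ 2 + xK + 1) := by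
  intro h
  obtain ⟨c₀, d₀, c₁, d₁, rfl⟩ := exists_eq_cubic_root_q z
  have hβ := of_mul_sq_ne_neg_radicand
  have hβ0 := radicand_ne_zero
  have hsq := constCoeff_q_not_sq
  have hT := root_q_pow_four
  have h3 := three_eq_zero_adjoinRoot_p
  have hD : AdjoinRoot.of p ((x ^ 3 + x) ^ 2 -
      (2 * x ^ 6 + 2 * x ^ 5 + x ^ 4 + 2 * x ^ 3 + 2 * x ^ 2)) =
      (xK ^ 3 + xK) ^ 2 - (2 * xK ^ 6 + 2 * xK ^ 5 + xK ^ 4 + 2 * xK ^ 3 + 2 * xK ^ 2) := by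
    simp only [map_add, map_sub, map_mul, map_pow, map_ofNat]
    rfl
  generalize (xK + 1) * y + xK ^ 3 + xK ^ 2 + xK + 1 = β at *
  generalize 2 * xK ^ 6 + 2 * xK ^ 5 + xK ^ 4 + 2 * xK ^ 3 + 2 * xK ^ 2 = b at *
  generalize xK ^ 3 + xK = a at *
  obtain ⟨e₀, e₁, e₂, e₃⟩ := eq_zero_of_cubic_root_q_eq_zero
    (a := c₀ ^ 2 - b * c₁ ^ 2 - b * (2 * d₀ * d₁ - a * d₁ ^ 2) + β)
    (b := 2 * (c₀ * d₀ - b * c₁ * d₁))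
    (c := 2 * c₀ * c₁ - a * c₁ ^ 2 + d₀ ^ 2 - b * d₁ ^ 2 - a * (2 * d₀ * d₁ - a * d₁ ^ 2))
    (d := 2 * (c₀ * d₁ + c₁ * d₀ - a * c₁ * d₁)) (by
      simp only [map_add, map_sub, map_mul, map_pow, map_ofNat]
      generalize AdjoinRoot.root q = T at *
      linear_combination h - (AdjoinRoot.of q c₁ ^ 2 +
        2 * AdjoinRoot.of q d₀ * AdjoinRoot.of q d₁ +
        2 * AdjoinRoot.of q c₁ * AdjoinRoot.of q d₁ * T +
        AdjoinRoot.of q d₁ ^ 2 * (T ^ 2 - AdjoinRoot.of q a)) * hT)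
  have hprod : (AdjoinRoot.of q c₀ + AdjoinRoot.of q c₁ * AdjoinRoot.root q ^ 2) *
      (AdjoinRoot.of q d₀ + AdjoinRoot.of q d₁ * AdjoinRoot.root q ^ 2) = 0 := by
    have f₁ : c₀ * d₀ - b * c₁ * d₁ = 0 := by
      linear_combination -e₁ + (c₀ * d₀ - b * c₁ * d₁) * h3
    have f₃ : c₀ * d₁ + c₁ * d₀ - a * c₁ * d₁ = 0 := by
      linear_combination -e₃ + (c₀ * d₁ + c₁ * d₀ - a * c₁ * d₁) * h3
    have g₁ := congrArg (AdjoinRoot.of q) f₁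
    have g₃ := congrArg (AdjoinRoot.of q) f₃
    simp only [map_add, map_sub, map_mul, map_zero] at g₁ g₃
    linear_combination g₁ + AdjoinRoot.root q ^ 2 * g₃ +
      AdjoinRoot.of q c₁ * AdjoinRoot.of q d₁ * hT
  rcases mul_eq_zero.mp hprod with hc | hd
  · obtain ⟨rfl, -, rfl, -⟩ := eq_zero_of_cubic_root_q_eq_zero
      (a := c₀) (b := 0) (c := c₁) (d := 0) (by simpa using hc)
    have hN : b * (d₀ ^ 2 - a * d₀ * d₁ + b * d₁ ^ 2) ^ 2 = β ^ 2 := by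
      linear_combination
        b * (d₀ ^ 2 - b * d₁ ^ 2) * e₂ - (b * (2 * d₀ * d₁ - a * d₁ ^ 2) + β) * e₀
    have hn : d₀ ^ 2 - a * d₀ * d₁ + b * d₁ ^ 2 ≠ 0 := fun h0 => by
      rw [h0] at hN
      exact pow_ne_zero 2 hβ0 (by simpa using hN.symm)
    refine hsq (β / (d₀ ^ 2 - a * d₀ * d₁ + b * d₁ ^ 2)) ?_
    rw [div_pow, div_eq_iff (pow_ne_zero 2 hn), hN]
  · obtain ⟨rfl, -, rfl, -⟩ := eq_zero_of_cubic_root_q_eq_zero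
      (a := d₀) (b := 0) (c := d₁) (d := 0) (by simpa using hd)
    have hc : c₁ * (2 * c₀ - a * c₁) = 0 := by linear_combination e₂
    rcases mul_eq_zero.mp hc with rfl | hc
    · refine hβ 1 c₀ ?_
      rw [map_one]
      linear_combination e₀
    · refine hβ ((x ^ 3 + x) ^ 2 -
        (2 * x ^ 6 + 2 * x ^ 5 + x ^ 4 + 2 * x ^ 3 + 2 * x ^ 2)) c₁ ?_
      rw [hD]
      linear_combination e₀ - (2 * c₀ + a * c₁) * hc + c₀ ^ 2 * h3

/-- Assuming `p` is irreducible (so `K = AdjoinRoot p = F₃(x)(y)` is a field) and the quartic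
`q` is irreducible over `K` (so `L = AdjoinRoot q` is a field), the polynomial
`T₂² + (x+1)y + x³+x²+x+1` is irreducible over `L`. -/
theorem stmt_8 [Fact (Irreducible p)] [Fact (Irreducible q)] :
    Irreducible (X ^ 2 +
      C (AdjoinRoot.of q ((xK + 1) * y + xK ^ 3 + xK ^ 2 + xK + 1)) :
      Polynomial (AdjoinRoot q)) := by
  refine irreducible_of_degree_le_three_of_not_isRoot ?_ fun z hz => ?_
  · rw [natDegree_X_pow_add_C]
    decide
  · refine sq_ne_neg_radicand z ?_
    rw [IsRoot, eval_add, eval_pow, eval_X, eval_C] at hz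
    exact eq_neg_of_add_eq_zero_left hz
end
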